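/- Let Γ be a finite partially ordered set whose longest chain has n elements. Then the chain-structured tropical matrix semigroup Γ(𝕋) satisfies exactly the same semigroup identities as UT_n(𝕋). -/

import Mathlib

/-- The tropical (max-plus) semiring `𝕋 = ℝ ∪ {-∞}`, with `⊕ = max` and `⊗ = +`. -/
abbrev TT : Type := WithBot ℝ

/-- Tropical (max-plus) multiplication of square matrices over `𝕋`:
`(A ⊗ B) i j = max_k (A i k + B k j)`. -/
def tmul {ι : Type} [Fintype ι] (A B : Matrix ι ι TT) : Matrix ι ι TT :=
  fun i j => Finset.univ.sup fun k => A i k + B k j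

/-- The image of a word under the semigroup homomorphism from the free semigroup `Σ⁺`
to tropical matrices determined by the letter assignment `a` (junk value on the empty word). -/
def evalWord {ι σ : Type} [Fintype ι] (a : σ → Matrix ι ι TT) : List σ → Matrix ι ι TT
  | [] => fun _ _ => ⊥
  | h :: t => t.foldl (fun M s => tmul M (a s)) (a h)

/-- A tropical matrix is upper triangular if all entries strictly below the diagonal are `-∞`. -/
def IsUT {n : ℕ} (A : Matrix (Fin n) (Fin n) TT) : Prop :=
  ∀ i j : Fin n, j < i → A i j = ⊥

theorem evalWord_singleton {ι σ : Type} [Fintype ι] (a : σ → Matrix ι ι TT) (s : σ) :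
    evalWord a [s] = a s := rfl

theorem evalWord_append_singleton {ι σ : Type} [Fintype ι] (a : σ → Matrix ι ι TT)
    {w : List σ} (hw : w ≠ []) (s : σ) :
    evalWord a (w ++ [s]) = tmul (evalWord a w) (a s) := by
  cases w with
  | nil => exact absurd rfl hw
  | cons h t => simp [evalWord]

/-- Induction on nonempty words by appending letters on the right. -/
theorem List.append_singleton_induction {σ : Type} {P : (w : List σ) → w ≠ [] → Prop}
    (single : ∀ s, P [s] (List.cons_ne_nil s []))
    (append : ∀ w s (hw : w ≠ []), P w hw → P (w ++ [s]) (by simp))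
    (w : List σ) (hw : w ≠ []) : P w hw := by
  induction w using List.reverseRecOn with
  | nil => exact absurd rfl hw
  | append_singleton w s ih =>
    by_cases h : w = []
    · subst h
      exact single s
    · exact append w s h (ih h)

/-- A matrix indexed by a preorder is triangular if it is `-∞` at `(i, j)` whenever `i ≰ j`. -/
def IsTriangular {ι : Type} [LE ι] (A : Matrix ι ι TT) : Prop :=
  ∀ i j, ¬ i ≤ j → A i j = ⊥

theorem isUT_iff_isTriangular {n : ℕ} (A : Matrix (Fin n) (Fin n) TT) :
    IsUT A ↔ IsTriangular A := by
  simp only [IsUT, IsTriangular, not_le]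

/-- The extension by `-∞` of a tropical matrix along a map of index sets. -/
noncomputable def extendMatrix {ι κ : Type} (f : ι → κ) (A : Matrix ι ι TT) : Matrix κ κ TT :=
  Function.extend f (fun p => Function.extend f (A p) ⊥) ⊥

theorem extendMatrix_apply {ι κ : Type} {f : ι → κ} (hf : f.Injective) (A : Matrix ι ι TT)
    (p q : ι) : extendMatrix f A (f p) (f q) = A p q := by
  simp [extendMatrix, hf.extend_apply]

theorem extendMatrix_eq_bot_of_left {ι κ : Type} {f : ι → κ} (A : Matrix ι ι TT)
    {i : κ} (hi : ¬ ∃ p, f p = i) (j : κ) : extendMatrix f A i j = ⊥ := by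
  simp [extendMatrix, Function.extend_apply' _ _ _ hi]

theorem extendMatrix_eq_bot_of_right {ι κ : Type} {f : ι → κ} (hf : f.Injective)
    (A : Matrix ι ι TT) (i : κ) {j : κ} (hj : ¬ ∃ q, f q = j) : extendMatrix f A i j = ⊥ := by
  by_cases hi : ∃ p, f p = i
  · obtain ⟨p, rfl⟩ := hi
    simp [extendMatrix, hf.extend_apply, Function.extend_apply' _ _ _ hj]
  · exact extendMatrix_eq_bot_of_left A hi j

theorem IsTriangular.extendMatrix {ι κ : Type} [LE ι] [LE κ] (f : ι ↪o κ)
    {A : Matrix ι ι TT} (hA : IsTriangular A) : IsTriangular (extendMatrix f A) := by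
  intro i j hij
  by_cases hi : ∃ p, f p = i
  · by_cases hj : ∃ q, f q = j
    · obtain ⟨p, rfl⟩ := hi
      obtain ⟨q, rfl⟩ := hj
      rw [extendMatrix_apply f.injective]
      exact hA p q fun h => hij (f.map_rel_iff.2 h)
    · exact extendMatrix_eq_bot_of_right f.injective A i hj
  · exact extendMatrix_eq_bot_of_left A hi j

theorem evalWord_extendMatrix {ι κ σ : Type} [Fintype ι] [Fintype κ] {f : ι → κ}
    (hf : f.Injective) (a : σ → Matrix ι ι TT) {w : List σ} (hw : w ≠ []) :
    ∀ p q, evalWord (fun s => extendMatrix f (a s)) w (f p) (f q) = evalWord a w p q := by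
  induction w, hw using List.append_singleton_induction with
  | single s => exact extendMatrix_apply hf (a s)
  | append w s hw ih =>
    intro p q
    rw [evalWord_append_singleton _ hw, evalWord_append_singleton _ hw]
    apply le_antisymm
    · refine Finset.sup_le fun k _ => ?_
      by_cases hk : ∃ r, f r = k
      · obtain ⟨r, rfl⟩ := hk
        rw [ih, extendMatrix_apply hf]
        exact Finset.le_sup (f := fun r => evalWord a w p r + a s r q) (Finset.mem_univ r)
      · simp [extendMatrix_eq_bot_of_left (a s) hk]
    · refine Finset.sup_le fun r _ => ?_
      rw [← ih, ← extendMatrix_apply hf (a s)]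
      exact Finset.le_sup (f := fun k => evalWord (fun s => extendMatrix f (a s)) w (f p) k +
        extendMatrix f (a s) k (f q)) (Finset.mem_univ (f r))

/-- Identities of triangular matrices pass to smaller index sets. -/
theorem evalWord_eq_of_orderEmbedding {ι κ σ : Type} [Fintype ι] [Fintype κ] [LE ι] [LE κ]
    (f : ι ↪o κ) {w v : List σ} (hw : w ≠ []) (hv : v ≠ [])
    (h : ∀ a : σ → Matrix κ κ TT, (∀ s, IsTriangular (a s)) → evalWord a w = evalWord a v)
    (a : σ → Matrix ι ι TT) (ha : ∀ s, IsTriangular (a s)) : evalWord a w = evalWord a v := by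
  ext p q : 2
  rw [← evalWord_extendMatrix f.injective a hw, ← evalWord_extendMatrix f.injective a hv,
    h _ fun s => (ha s).extendMatrix f]

theorem evalWord_submatrix_le {ι κ σ : Type} [Fintype ι] [Fintype κ] (f : ι → κ)
    (a : σ → Matrix κ κ TT) {w : List σ} (hw : w ≠ []) :
    ∀ p q, evalWord (fun s => (a s).submatrix f f) w p q ≤ evalWord a w (f p) (f q) := by
  induction w, hw using List.append_singleton_induction with
  | single s => exact fun p q => le_rfl
  | append w s hw ih =>
    intro p q
    rw [evalWord_append_singleton _ hw, evalWord_append_singleton _ hw]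
    exact Finset.sup_le fun r _ => (add_le_add_left (ih p r) _).trans
      (Finset.le_sup (f := fun k => evalWord a w (f p) k + a s k (f q)) (Finset.mem_univ (f r)))

/-- A finite chain with greatest element `k` extends to one with greatest element `j ≥ k`. -/
theorem exists_strictMono_extension {Γ : Type} [PartialOrder Γ] {m : ℕ} {c : Fin m → Γ}
    (hc : StrictMono c) {k j : Γ} (hk : ∀ x, c x ≤ k) (hmem : ∃ r, c r = k) (hkj : k ≤ j) :
    ∃ (m' : ℕ) (c' : Fin m' → Γ) (e : Fin m → Fin m'), StrictMono c' ∧ c' ∘ e = c ∧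
      (∀ x, c' x ≤ j) ∧ ∃ q, c' q = j := by
  rcases hkj.eq_or_lt with rfl | hlt
  · exact ⟨m, c, id, hc, rfl, hk, hmem⟩
  · refine ⟨m + 1, Fin.snoc c j, Fin.castSucc, ?_, ?_, ?_, Fin.last m, by simp⟩
    · intro x y hxy
      induction x using Fin.lastCases with
      | last => exact absurd hxy (Fin.le_last y).not_gt
      | cast x =>
        induction y using Fin.lastCases with
        | last => simpa using (hk x).trans_lt hlt
        | cast y => simpa using hc (Fin.castSucc_lt_castSucc_iff.1 hxy)
    · ext x
      simp
    · intro x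
      induction x using Fin.lastCases with
      | last => simp
      | cast x => simpa using (hk x).trans hkj

/-- Each finite entry of a product of triangular matrices is already attained on a chain. -/
theorem exists_strictMono_le_evalWord_submatrix {Γ σ : Type} [Fintype Γ] [PartialOrder Γ]
    (a : σ → Matrix Γ Γ TT) (ha : ∀ s, IsTriangular (a s)) {w : List σ} (hw : w ≠ []) (i : Γ) :
    ∀ j, evalWord a w i j ≠ ⊥ → ∃ (m : ℕ) (c : Fin m → Γ), StrictMono c ∧ (∀ x, c x ≤ j) ∧
      ∃ p q, c p = i ∧ c q = j ∧
        evalWord a w i j ≤ evalWord (fun s => (a s).submatrix c c) w p q := by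
  induction w, hw using List.append_singleton_induction with
  | single s =>
    intro j hj
    have hij : i ≤ j := by
      by_contra h
      exact hj (ha s i j h)
    obtain ⟨m, c, e, hc, hce, hle, q, hq⟩ :=
      exists_strictMono_extension (c := fun _ : Fin 1 => i) (Subsingleton.strictMono _)
        (fun _ => le_rfl) ⟨0, rfl⟩ hij
    have hp : c (e 0) = i := congrFun hce 0
    refine ⟨m, c, hc, hle, e 0, q, hp, hq, ?_⟩
    simp [evalWord_singleton, hp, hq]
  | append w s hw ih =>
    intro j hj
    rw [evalWord_append_singleton _ hw] at hj
    obtain ⟨k, -, hk⟩ := Finset.exists_mem_eq_sup Finset.univ ⟨i, Finset.mem_univ i⟩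
      fun k => evalWord a w i k + a s k j
    change tmul (evalWord a w) (a s) i j = _ at hk
    rw [hk, Ne, WithBot.add_eq_bot, not_or] at hj
    have hkj : k ≤ j := by
      by_contra h
      exact hj.2 (ha s k j h)
    obtain ⟨m, c, hc, hle, p, r, hp, hr, h⟩ := ih k hj.1
    obtain ⟨m', c', e, hc', rfl, hle', q, hq⟩ := exists_strictMono_extension hc hle ⟨r, hr⟩ hkj
    refine ⟨m', c', hc', hle', e p, q, hp, hq, ?_⟩
    rw [evalWord_append_singleton _ hw, evalWord_append_singleton _ hw, hk]
    refine le_trans (add_le_add (h.trans (evalWord_submatrix_le e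
      (fun s => (a s).submatrix c' c') hw p r)) ?_)
      (Finset.le_sup (f := fun x => evalWord (fun s => (a s).submatrix c' c') w (e p) x +
        (a s).submatrix c' c' x q) (Finset.mem_univ (e r)))
    rw [← hr, ← hq]
    rfl

theorem evalWord_le_of_chains {Γ σ : Type} [Fintype Γ] [PartialOrder Γ] {w v : List σ}
    (hw : w ≠ []) (hv : v ≠ [])
    (h : ∀ (m : ℕ) (c : Fin m → Γ), StrictMono c → ∀ a : σ → Matrix (Fin m) (Fin m) TT,
      (∀ s, IsTriangular (a s)) → evalWord a w = evalWord a v)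
    (a : σ → Matrix Γ Γ TT) (ha : ∀ s, IsTriangular (a s)) (i j : Γ) :
    evalWord a w i j ≤ evalWord a v i j := by
  by_cases hbot : evalWord a w i j = ⊥
  · simp [hbot]
  · obtain ⟨m, c, hc, -, p, q, rfl, rfl, hle⟩ :=
      exists_strictMono_le_evalWord_submatrix a ha hw i j hbot
    rw [h m c hc (fun s => (a s).submatrix c c) fun s x y hxy =>
      ha s _ _ fun hcc => hxy (hc.le_iff_le.1 hcc)] at hle
    exact hle.trans (evalWord_submatrix_le c a hv p q)

/-- Let `Γ` be a finite partially ordered set whose longest chain has `n`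
elements (there is a strictly increasing sequence of `n` elements, and none longer). Then the
chain-structured tropical matrix semigroup `Γ(𝕋)` (functions `A : Γ × Γ → 𝕋` with
`A_{i,j} = -∞` whenever `i ≰ j`, under tropical matrix multiplication) satisfies exactly the
same semigroup identities as `UT_n(𝕋)`. -/
theorem stmt_15 (Γ : Type) [Fintype Γ] [PartialOrder Γ] (n : ℕ)
    (hex : ∃ c : Fin n → Γ, StrictMono c)
    (hmax : ∀ (m : ℕ) (c : Fin m → Γ), StrictMono c → m ≤ n)
    (σ : Type) [Fintype σ] (w v : List σ) (hw : w ≠ []) (hv : v ≠ []) :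
    (∀ a : σ → Matrix Γ Γ TT, (∀ s i j, ¬ i ≤ j → a s i j = ⊥) →
      evalWord a w = evalWord a v)
    ↔ (∀ a : σ → Matrix (Fin n) (Fin n) TT, (∀ s, IsUT (a s)) →
        evalWord a w = evalWord a v) := by
  simp only [isUT_iff_isTriangular]
  constructor
  · intro h
    obtain ⟨c, hc⟩ := hex
    exact evalWord_eq_of_orderEmbedding (OrderEmbedding.ofStrictMono c hc) hw hv h
  · intro h a ha
    have hchain : ∀ (m : ℕ) (c : Fin m → Γ), StrictMono c →
        ∀ b : σ → Matrix (Fin m) (Fin m) TT, (∀ s, IsTriangular (b s)) →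
          evalWord b w = evalWord b v := fun m c hc =>
      evalWord_eq_of_orderEmbedding (Fin.castLEOrderEmb (hmax m c hc)) hw hv h
    ext i j : 2
    exact le_antisymm (evalWord_le_of_chains hw hv hchain a ha i j)
      (evalWord_le_of_chains hv hw
        (fun m c hc b hb => (hchain m c hc b hb).symm) a ha i j)
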